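/- arXiv:2007.08845 — 2 statements merged into one kernel-verified Lean document; each statement's English description precedes it below -/
import Mathlib

section
/- Let (X,τ) be a Hausdorff topological space and let S ⊆ X be a subset that is both dense and co-dense (i.e., X \ S is also dense) in X. If the subspace S with the induced topology is homeomorphic to the Sorgenfrey line, then (X,τ) is not a continuous open image of the Sorgenfrey line; that is, there is no surjection from the Sorgenfrey line onto X that is continuous and an open map. -/
open Set Filter Topology TopologicalSpace Function

noncomputable section

/-- The Sorgenfrey topology on `ℝ`: generated by half-open intervals `[a, b)`. -/
def sorgenfreyTop : TopologicalSpace ℝ :=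
  TopologicalSpace.generateFrom {s : Set ℝ | ∃ a b : ℝ, s = Set.Ico a b}

/-- The initial segment `p↾n` of an infinite sequence, as a list. -/
def restr (p : ℕ → ℕ) (n : ℕ) : List ℕ := (List.range n).map p

/-- `fruit V p = ⋂ n, V (p↾n)`. -/
def fruit {X : Type*} (V : List ℕ → Set X) (p : ℕ → ℕ) : Set X := ⋂ n, V (restr p n)

/-- A Souslin scheme is covering if `V ⟨⟩ = X` and `V a = ⋃ n, V (a ⌢ n)`. -/
def Covering {X : Type*} (V : List ℕ → Set X) : Prop :=
  V [] = Set.univ ∧ ∀ a : List ℕ, V a = ⋃ n : ℕ, V (a ++ [n])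

/-- A Souslin scheme is complete if every fruit is nonempty. -/
def CompleteScheme {X : Type*} (V : List ℕ → Set X) : Prop :=
  ∀ q : ℕ → ℕ, (fruit V q).Nonempty

/-- A Souslin scheme has strict branches if every fruit is a singleton. -/
def StrictBranches {X : Type*} (V : List ℕ → Set X) : Prop :=
  ∀ q : ℕ → ℕ, ∃ x : X, fruit V q = {x}

/-- A Souslin scheme is locally strict. -/
def LocallyStrict {X : Type*} (V : List ℕ → Set X) : Prop :=
  (∀ a : List ℕ, V a = ⋃ n : ℕ, V (a ++ [n])) ∧
  ∀ a : List ℕ, ∀ m k : ℕ, m ≠ k → V (a ++ [m]) ∩ V (a ++ [k]) = ∅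

/-- `q ◁ p` for infinite sequences: `q↾n = p↾n` and `q n < p n` for some `n`. -/
def tri (q p : ℕ → ℕ) : Prop := ∃ n : ℕ, restr q n = restr p n ∧ q n < p n

/-- `q ⊴ p` for infinite sequences. -/
def trieq (q p : ℕ → ℕ) : Prop := tri q p ∨ q = p

/-- `q ◁ s` where `q` is an infinite sequence and `s` a finite one. -/
def triL (q : ℕ → ℕ) (s : List ℕ) : Prop :=
  ∃ n : ℕ, ∃ h : n < s.length, restr q n = s.take n ∧ q n < s.get ⟨n, h⟩

/-- `rsequences(q, n) = {p | q ◁ p ∧ q↾n = p↾n}`. -/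
def rsequences (q : ℕ → ℕ) (n : ℕ) : Set (ℕ → ℕ) :=
  {p | tri q p ∧ restr q n = restr p n}

/-- `rsubtree(q, n)`: finite sequences `s` such that `q↾n ⊏ s` and `q ◁ s`. -/
def rsubtree (q : ℕ → ℕ) (n : ℕ) : Set (List ℕ) :=
  {s | restr q n <+: s ∧ restr q n ≠ s ∧ triL q s}

/-- `cut(V, q, n) = ⋃ {fruit(V, p) : p ∈ rsequences(q, n)}`. -/
def cut {X : Type*} (V : List ℕ → Set X) (q : ℕ → ℕ) (n : ℕ) : Set X :=
  ⋃ p ∈ rsequences q n, fruit V p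

/-- `branches(V, x) = {q | x ∈ fruit(V, q)}`. -/
def branches {X : Type*} (V : List ℕ → Set X) (x : X) : Set (ℕ → ℕ) :=
  {q | x ∈ fruit V q}

/-- `q` is a `τ`-base branch of `x` in `V`: `q ∈ branches(V, x)` and
`{cut(V, q, m) ∪ {x} : m ∈ ℕ}` is a neighborhood base of open sets at `x`. -/
def IsBaseBranch {X : Type*} (τ : TopologicalSpace X) (V : List ℕ → Set X)
    (q : ℕ → ℕ) (x : X) : Prop :=
  x ∈ fruit V q ∧ (∀ m : ℕ, IsOpen[τ] (cut V q m ∪ {x})) ∧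
    (@nhds X τ x).HasBasis (fun _ : ℕ => True) (fun m : ℕ => cut V q m ∪ {x})

/-- `BB(V, x, τ)`: the set of `τ`-base branches of `x` in `V`. -/
def BB {X : Type*} (τ : TopologicalSpace X) (V : List ℕ → Set X) (x : X) : Set (ℕ → ℕ) :=
  {q | IsBaseBranch τ V q x}

/-- A Sorgenfrey base for a space: an open complete covering Souslin scheme
satisfying (S1) and (S2). -/
def IsSorgenfreyBase {X : Type*} (τ : TopologicalSpace X) (V : List ℕ → Set X) : Prop :=
  (∀ a : List ℕ, IsOpen[τ] (V a)) ∧ CompleteScheme V ∧ Covering V ∧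
  (∀ x : X, ∀ q ∈ branches V x, ∀ n : ℕ, ∃ t ∈ BB τ V x, restr t n = restr q n) ∧
  (∀ q : ℕ → ℕ, ∃ z : X, q ∈ BB τ V z)

/-- The Souslin scheme `S` on the Baire set: `S a = {p | a ⊑ p}`. -/
def SchemeS (a : List ℕ) : Set (ℕ → ℕ) := {p | restr p a.length = a}

/-- The topology `σ_𝕊` on `ℕ → ℕ` generated by the base
`{cut(S, p, n) ∪ {p} : p ∈ ℕ → ℕ, n ∈ ℕ}`. -/
def sigmaS : TopologicalSpace (ℕ → ℕ) :=
  TopologicalSpace.generateFrom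
    {U : Set (ℕ → ℕ) | ∃ p : ℕ → ℕ, ∃ n : ℕ, U = cut SchemeS p n ∪ {p}}

/-- Sorgenfrey neighbourhoods of a point contain a half-open interval starting there. -/
theorem exists_Ico_subset_of_isOpen_sorgenfreyTop {U : Set ℝ} (hU : IsOpen[sorgenfreyTop] U)
    {x : ℝ} (hx : x ∈ U) : ∃ δ > 0, Ico x (x + δ) ⊆ U := by
  induction hU with
  | basic s hs =>
    obtain ⟨a, b, rfl⟩ := hs
    exact ⟨b - x, sub_pos.2 hx.2, fun y hy => ⟨hx.1.trans hy.1, by linarith [hy.2]⟩⟩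
  | univ => exact ⟨1, one_pos, subset_univ _⟩
  | inter s t _ _ ihs iht =>
    obtain ⟨δ₁, h₁, hs⟩ := ihs hx.1
    obtain ⟨δ₂, h₂, ht⟩ := iht hx.2
    refine ⟨min δ₁ δ₂, lt_min h₁ h₂, fun y hy => ⟨hs ⟨hy.1, ?_⟩, ht ⟨hy.1, ?_⟩⟩⟩
    · linarith [hy.2, min_le_left δ₁ δ₂]
    · linarith [hy.2, min_le_right δ₁ δ₂]
  | sUnion s _ ih =>
    obtain ⟨t, hts, hxt⟩ := hx
    obtain ⟨δ, hδ, hsub⟩ := ih t hts hxt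
    exact ⟨δ, hδ, hsub.trans (subset_sUnion_of_mem hts)⟩

theorem isOpen_sorgenfreyTop_Ico (a b : ℝ) : IsOpen[sorgenfreyTop] (Ico a b) :=
  TopologicalSpace.isOpen_generateFrom_of_mem ⟨a, b, rfl⟩

/-- The right-hand upper limit along `A` of a function bounded on `A` near `p`. -/
theorem exists_right_limsup {A : Set ℝ} (hA : Dense A) {h : ℝ → ℝ} {p δ₀ m M : ℝ} (hδ₀ : 0 < δ₀)
    (hm : ∀ a ∈ A, a ∈ Ico p (p + δ₀) → m ≤ h a ∧ h a ≤ M) :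
    ∃ F : ℝ, (∀ ε > 0, ∃ δ > 0, ∀ a ∈ A, a ∈ Ico p (p + δ) → h a < F + ε) ∧
      ∀ ε > 0, ∀ δ > 0, ∃ a ∈ A, a ∈ Ico p (p + δ) ∧ F - ε < h a := by
  set T : Set ℝ := {c | ∃ δ > 0, ∀ a ∈ A, a ∈ Ico p (p + δ) → h a ≤ c} with hT
  have hne : T.Nonempty := ⟨M, δ₀, hδ₀, fun a ha hap => (hm a ha hap).2⟩
  have hbdd : BddBelow T := by
    refine ⟨m, ?_⟩
    rintro c ⟨δ, hδ, hc⟩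
    obtain ⟨a, ha, hpa, hap⟩ := hA.exists_between (show p < p + min δ δ₀ by
      linarith [lt_min hδ hδ₀])
    exact (hm a ha ⟨hpa.le, by linarith [min_le_right δ δ₀]⟩).1.trans
      (hc a ha ⟨hpa.le, by linarith [min_le_left δ δ₀]⟩)
  refine ⟨sInf T, fun ε hε => ?_, fun ε hε δ hδ => ?_⟩
  · obtain ⟨c, ⟨δ, hδ, hc⟩, hlt⟩ := exists_lt_of_csInf_lt hne (lt_add_of_pos_right (sInf T) hε)
    exact ⟨δ, hδ, fun a ha hap => (hc a ha hap).trans_lt hlt⟩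
  · by_contra! hcon
    linarith [csInf_le hbdd (show sInf T - ε ∈ T from ⟨δ, hδ, hcon⟩)]

/-- There is no right-continuous, nowhere locally constant real function on a dense co-dense
set `A ⊆ ℝ`, approaching its values from above, that has no Sorgenfrey cluster value from the right
at any point outside `A`. -/
theorem false_of_no_right_cluster_value {A : Set ℝ} (hA : Dense A) (hAc : Dense Aᶜ) (h : ℝ → ℝ)
    (hcont : ∀ q ∈ A, ∀ ε > 0, ∃ δ > 0, ∀ a ∈ A, a ∈ Ico q (q + δ) → h a ∈ Ico (h q) (h q + ε))
    (hext : ∀ p ∉ A, ∀ L : ℝ, ∃ ε > 0, ∃ δ > 0, ∀ a ∈ A, a ∈ Ico p (p + δ) →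
      h a ∉ Ico L (L + ε))
    (hconst : ∀ q ∈ A, ∀ δ > 0, ∃ a ∈ A, a ∈ Ico q (q + δ) ∧ h a ≠ h q) : False := by
  obtain ⟨q₀, hq₀⟩ := hA.nonempty
  obtain ⟨δ₀, hδ₀, hbound⟩ := hcont q₀ hq₀ 1 one_pos
  -- `F` is the right-hand upper limit of `h`.
  have hF : ∀ p : ℝ, ∃ F : ℝ, p ∈ Ioo q₀ (q₀ + δ₀) →
      (p ∈ A → F = h p) ∧ (∀ ε > 0, ∃ δ > 0, ∀ a ∈ A, a ∈ Ico p (p + δ) → h a < F + ε) ∧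
      ∀ ε > 0, ∀ δ > 0, ∃ a ∈ A, a ∈ Ico p (p + δ) ∧ F - ε < h a := by
    intro p
    by_cases hpA : p ∈ A
    · refine ⟨h p, fun _ => ⟨fun _ => rfl, fun ε hε => ?_, fun ε hε δ hδ => ?_⟩⟩
      · obtain ⟨δ, hδ, H⟩ := hcont p hpA ε hε
        exact ⟨δ, hδ, fun a ha hap => (H a ha hap).2⟩
      · exact ⟨p, hpA, ⟨le_rfl, by linarith⟩, by linarith⟩
    · by_cases hp : p ∈ Ioo q₀ (q₀ + δ₀)
      · obtain ⟨F, h₁, h₂⟩ := exists_right_limsup hA (h := h) (p := p) (δ₀ := q₀ + δ₀ - p)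
          (m := h q₀) (M := h q₀ + 1) (by linarith [hp.2]) (fun a ha hap => by
            have := hbound a ha ⟨by linarith [hp.1, hap.1], by linarith [hap.2]⟩
            exact ⟨this.1, this.2.le⟩)
        exact ⟨F, fun _ => ⟨fun hh => absurd hh hpA, h₁, h₂⟩⟩
      · exact ⟨0, fun hh => absurd hh hp⟩
  choose F hF using hF
  let E : ℕ × Bool → Set ℝ := fun i => {p | p ∈ Ioo q₀ (q₀ + δ₀) →
    if i.2 then p ∈ A ∧ ∀ a ∈ A, a ∈ Ico p (p + 1 / ((i.1 : ℝ) + 1)) → h p ≤ h a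
    else ∀ a ∈ A, a ∈ Ico p (p + 1 / ((i.1 : ℝ) + 1)) → h a ≤ F p}
  have hcover : ⋃ i, closure (E i) = univ := by
    refine eq_univ_of_forall fun p => mem_iUnion.2 ?_
    by_cases hp : p ∈ Ioo q₀ (q₀ + δ₀)
    · by_cases hpA : p ∈ A
      · obtain ⟨δ, hδ, H⟩ := hcont p hpA 1 one_pos
        obtain ⟨n, hn⟩ := exists_nat_one_div_lt hδ
        refine ⟨(n, true), subset_closure fun _ => ?_⟩
        simp only [if_true]
        exact ⟨hpA, fun a ha hap => (H a ha ⟨hap.1, by linarith [hap.2]⟩).1⟩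
      · obtain ⟨ε, hε, δ₁, hδ₁, H₁⟩ := hext p hpA (F p)
        obtain ⟨δ₂, hδ₂, H₂⟩ := (hF p hp).2.1 ε hε
        obtain ⟨n, hn⟩ := exists_nat_one_div_lt (lt_min hδ₁ hδ₂)
        refine ⟨(n, false), subset_closure fun _ => ?_⟩
        simp only [Bool.false_eq_true, if_false]
        intro a ha hap
        by_contra! hlt
        exact H₁ a ha ⟨hap.1, by linarith [hap.2, min_le_left δ₁ δ₂]⟩
          ⟨hlt.le, H₂ a ha ⟨hap.1, by linarith [hap.2, min_le_right δ₁ δ₂]⟩⟩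
    · exact ⟨(0, true), subset_closure fun hh => absurd hh hp⟩
  have hdense := dense_iUnion_interior_of_closed (fun i => isClosed_closure (s := E i)) hcover
  obtain ⟨x, hxI, hx⟩ := hdense.inter_open_nonempty (Ioo q₀ (q₀ + δ₀)) isOpen_Ioo
    (nonempty_Ioo.2 (by linarith))
  obtain ⟨⟨n, b⟩, hxE⟩ := mem_iUnion.1 hx
  obtain ⟨r, hr, hball⟩ := Metric.isOpen_iff.1 (isOpen_interior.inter isOpen_Ioo) x ⟨hxE, hxI⟩
  set N : ℝ := 1 / ((n : ℝ) + 1) with hN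
  have hNpos : 0 < N := by positivity
  -- A short interval to the right of `x` in which `E (n, b)` is dense.
  set y : ℝ := x + min r N with hy
  have hxy : x < y := by linarith [lt_min hr hNpos]
  have hyr : y ≤ x + r := by linarith [min_le_left r N]
  have hyN : y ≤ x + N := by linarith [min_le_right r N]
  have hJ : Ioo x y ⊆ interior (closure (E (n, b))) ∩ Ioo q₀ (q₀ + δ₀) := by
    intro z hz
    apply hball
    rw [Real.ball_eq_Ioo]
    exact ⟨by linarith [hz.1], by linarith [hz.2]⟩
  have hbtw : ∀ u v : ℝ, x ≤ u → u < v → v ≤ y → ∃ e ∈ E (n, b), u < e ∧ e < v := by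
    intro u v hxu huv hvy
    obtain ⟨w, huw, hwv⟩ := exists_between huv
    have hw : w ∈ closure (E (n, b)) :=
      interior_subset (hJ ⟨by linarith, by linarith⟩).1
    obtain ⟨e, ⟨h₁, h₂⟩, heE⟩ := mem_closure_iff.1 hw (Ioo u v) isOpen_Ioo ⟨huw, hwv⟩
    exact ⟨e, heE, h₁, h₂⟩
  cases b with
  | false =>
    -- `h` is nonincreasing, hence locally constant.
    have hanti : ∀ q ∈ A, ∀ q' ∈ A, x < q → q < q' → q' < y → h q' ≤ h q := by
      intro q hq q' hq' hxq hqq' hqy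
      refine le_of_forall_pos_le_add fun ε hε => ?_
      obtain ⟨δ, hδ, H⟩ := hcont q hq (ε / 2) (half_pos hε)
      obtain ⟨e, he, hqe, hev⟩ := hbtw q (min q' (q + δ)) hxq.le
        (lt_min hqq' (by linarith)) ((min_le_left _ _).trans hqy.le)
      have heq' : e < q' := hev.trans_le (min_le_left _ _)
      have heδ : e < q + δ := hev.trans_le (min_le_right _ _)
      have heI := (hJ (show e ∈ Ioo x y from ⟨by linarith, by linarith⟩)).2
      have h₁ := he heI
      simp only [Bool.false_eq_true, if_false] at h₁
      have h₂ := h₁ q' hq' ⟨heq'.le, by linarith⟩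
      obtain ⟨a, ha, hae, hFa⟩ := (hF e heI).2.2 (ε / 2) (half_pos hε) (q + δ - e) (by linarith)
      have h₃ := (H a ha ⟨by linarith [hae.1], by linarith [hae.2]⟩).2
      linarith
    obtain ⟨q, hq, hxq, hqy⟩ := hA.exists_between hxy
    obtain ⟨δ, hδ, H⟩ := hcont q hq 1 one_pos
    obtain ⟨a, ha, haq, hne⟩ := hconst q hq (min δ (y - q)) (lt_min hδ (by linarith))
    have hlt : q < a := haq.1.lt_of_ne fun hqa => hne (by rw [hqa])
    exact hne (le_antisymm
      (hanti q hq a ha hxq hlt (by linarith [haq.2, min_le_right δ (y - q)]))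
      (H a ha ⟨haq.1, by linarith [haq.2, min_le_left δ (y - q)]⟩).1)
  | true =>
    -- `h` is nondecreasing, hence has a right limit at every point.
    have hmono : ∀ q ∈ A, ∀ q' ∈ A, x < q → q < q' → q' < y → h q ≤ h q' := by
      intro q hq q' hq' hxq hqq' hqy
      obtain ⟨δ, hδ, H⟩ := hcont q hq 1 one_pos
      obtain ⟨e, he, hqe, hev⟩ := hbtw q (min q' (q + δ)) hxq.le
        (lt_min hqq' (by linarith)) ((min_le_left _ _).trans hqy.le)
      have heq' : e < q' := hev.trans_le (min_le_left _ _)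
      have heδ : e < q + δ := hev.trans_le (min_le_right _ _)
      have h₁ := he (hJ (show e ∈ Ioo x y from ⟨by linarith, by linarith⟩)).2
      simp only [if_true] at h₁
      exact (H e h₁.1 ⟨hqe.le, heδ⟩).1.trans (h₁.2 q' hq' ⟨heq'.le, by linarith⟩)
    obtain ⟨p, hp, hxp, hpy⟩ := hAc.exists_between hxy
    obtain ⟨q, hq, hxq, hqp⟩ := hA.exists_between hxp
    obtain ⟨q', hq', hpq', hq'y⟩ := hA.exists_between hpy
    set T : Set ℝ := h '' (A ∩ Ioo p y) with hT
    have hbdd : BddBelow T := by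
      refine ⟨h q, ?_⟩
      rintro _ ⟨a, ⟨ha, hpa, hay⟩, rfl⟩
      exact hmono q hq a ha hxq (hqp.trans hpa) hay
    obtain ⟨ε, hε, δ, hδ, H⟩ := hext p hp (sInf T)
    obtain ⟨_, ⟨a, ⟨ha, hpa, hay⟩, rfl⟩, hlt⟩ := exists_lt_of_csInf_lt
      (show T.Nonempty from ⟨h q', q', ⟨hq', hpq', hq'y⟩, rfl⟩)
      (lt_add_of_pos_right (sInf T) hε)
    obtain ⟨c, hc, hpc, hcv⟩ := hA.exists_between (lt_min hpa (lt_add_of_pos_right p hδ))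
    have hca : c < a := hcv.trans_le (min_le_left _ _)
    exact H c hc ⟨hpc.le, hcv.trans_le (min_le_right _ _)⟩
      ⟨csInf_le hbdd ⟨c, ⟨hc, hpc, hca.trans hay⟩, rfl⟩,
        (hmono c hc a ha (hxp.trans hpc) hca hay).trans_lt hlt⟩

/-- Preimages of dense sets under Sorgenfrey-open maps are dense in the usual topology. -/
theorem Dense.preimage_of_isOpenMap_sorgenfreyTop {X : Type*} [τ : TopologicalSpace X] {S : Set X}
    (hS : Dense S) {f : ℝ → X} (hf : @IsOpenMap ℝ X sorgenfreyTop τ f) : Dense (f ⁻¹' S) := by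
  refine dense_of_exists_between fun a b hab => ?_
  obtain ⟨c, hac, hcb⟩ := _root_.exists_between hab
  obtain ⟨_, ⟨z, hz, rfl⟩, hzS⟩ := hS.inter_open_nonempty (f '' Ico c b)
    (hf _ (isOpen_sorgenfreyTop_Ico c b)) ⟨f c, c, ⟨le_rfl, hcb⟩, rfl⟩
  exact ⟨z, hzS, hac.trans_le hz.1, hz.2⟩

/-- If a Hausdorff space has a dense and co-dense subspace homeomorphic to the
Sorgenfrey line, then it is not a continuous open image of the Sorgenfrey line. -/
theorem stmt15 {X : Type*} (τ : TopologicalSpace X) (hT2 : @T2Space X τ)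
    (S : Set X) (hd : @Dense X τ S) (hcd : @Dense X τ Sᶜ)
    (h : Nonempty (@Homeomorph ↥S ℝ (TopologicalSpace.induced Subtype.val τ) sorgenfreyTop)) :
    ¬ ∃ f : ℝ → X, @Continuous ℝ X sorgenfreyTop τ f ∧
      @IsOpenMap ℝ X sorgenfreyTop τ f ∧ Function.Surjective f := by
  rintro ⟨f, hfc, hfo, -⟩
  obtain ⟨e, hec, hes⟩ : ∃ e : S ≃ ℝ,
      Continuous[TopologicalSpace.induced Subtype.val τ, sorgenfreyTop] e ∧
      Continuous[sorgenfreyTop, TopologicalSpace.induced Subtype.val τ] e.symm := by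
    obtain ⟨e⟩ := h
    exact ⟨@Homeomorph.toEquiv _ _ (_) (_) e, @Homeomorph.continuous_toFun _ _ (_) (_) e,
      @Homeomorph.continuous_invFun _ _ (_) (_) e⟩
  classical
  let g : ℝ → X := fun t => (e.symm t : X)
  let k : ℝ → ℝ := fun a => if ha : f a ∈ S then e ⟨f a, ha⟩ else 0
  have hgk : ∀ a ∈ f ⁻¹' S, g (k a) = f a := by
    intro a ha
    have ha' : f a ∈ S := ha
    simp [g, k, ha']
  have hkg : ∀ a t, f a = g t → k a = t := by
    intro a t hat
    have ha' : f a ∈ S := hat ▸ (e.symm t).2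
    have : (⟨f a, ha'⟩ : S) = e.symm t := Subtype.ext hat
    simp [k, ha', this]
  have hgc : @Continuous ℝ X sorgenfreyTop τ g :=
    @Continuous.comp _ _ _ sorgenfreyTop (TopologicalSpace.induced Subtype.val τ) τ _ _
      continuous_subtype_val hes
  -- Sorgenfrey-open sets are traces of open sets along `g`.
  have hgo : ∀ V : Set ℝ, IsOpen[sorgenfreyTop] V → ∃ W : Set X, IsOpen[τ] W ∧ g ⁻¹' W = V := by
    intro V hV
    obtain ⟨W, hW, hWV⟩ := isOpen_induced_iff.1 (continuous_def.1 hec V hV)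
    refine ⟨W, hW, ?_⟩
    ext t
    have := Set.ext_iff.1 hWV (e.symm t)
    simpa [g] using this
  refine false_of_no_right_cluster_value (hd.preimage_of_isOpenMap_sorgenfreyTop hfo)
    (hcd.preimage_of_isOpenMap_sorgenfreyTop hfo) k ?_ ?_ ?_
  · intro q hq ε hε
    obtain ⟨W, hW, hWV⟩ := hgo _ (isOpen_sorgenfreyTop_Ico (k q) (k q + ε))
    have hmem : ∀ a ∈ f ⁻¹' S, (f a ∈ W ↔ k a ∈ Ico (k q) (k q + ε)) := by
      intro a ha
      rw [← hWV, mem_preimage, hgk a ha]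
    obtain ⟨δ, hδ, hsub⟩ := exists_Ico_subset_of_isOpen_sorgenfreyTop
      (continuous_def.1 hfc W hW) (x := q) ((hmem q hq).2 ⟨le_rfl, by linarith⟩)
    exact ⟨δ, hδ, fun a ha haq => (hmem a ha).1 (hsub haq)⟩
  · intro p hp L
    have hne : f p ≠ g L := fun hpL => hp (show f p ∈ S from hpL ▸ (e.symm L).2)
    obtain ⟨U, V, hU, hV, hpU, hLV, hUV⟩ := t2_separation hne
    obtain ⟨δ, hδ, hδU⟩ := exists_Ico_subset_of_isOpen_sorgenfreyTop
      (continuous_def.1 hfc U hU) (x := p) hpU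
    obtain ⟨ε, hε, hεV⟩ := exists_Ico_subset_of_isOpen_sorgenfreyTop
      (continuous_def.1 hgc V hV) (x := L) hLV
    refine ⟨ε, hε, δ, hδ, fun a ha hap hka => ?_⟩
    exact disjoint_left.1 hUV (hδU hap) (hgk a ha ▸ hεV hka)
  · intro q hq δ hδ
    have hopen := continuous_def.1 hgc _ (hfo _ (isOpen_sorgenfreyTop_Ico q (q + δ)))
    obtain ⟨ε, hε, hsub⟩ := exists_Ico_subset_of_isOpen_sorgenfreyTop hopen (x := k q)
      ⟨q, ⟨le_rfl, by linarith⟩, (hgk q hq).symm⟩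
    obtain ⟨a, ha, hfa⟩ := hsub (show k q + ε / 2 ∈ Ico (k q) (k q + ε) from
      ⟨by linarith, by linarith⟩)
    refine ⟨a, show f a ∈ S from hfa ▸ (e.symm _).2, ha, ?_⟩
    rw [hkg a _ hfa]
    linarith
end
end

section
/- Let X be a compact Hausdorff space containing a dense subset D such that the subspace D is homeomorphic to the Sorgenfrey line (i.e., X is a Hausdorff compactification of the Sorgenfrey line). Then X is not a continuous open image of the Sorgenfrey line; that is, there is no surjection from the Sorgenfrey line onto X that is continuous and an open map. -/
open Set Filter Topology TopologicalSpace Function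

noncomputable section

theorem nhds_sorgenfreyTop (a : ℝ) : @nhds ℝ sorgenfreyTop a = 𝓝[≥] a := by
  have hbasis : (𝓝[≥] a).HasBasis (fun u => a < u) (fun u => Ico a u) := nhdsGE_basis a
  rw [sorgenfreyTop, TopologicalSpace.nhds_generateFrom]
  apply le_antisymm
  · refine hbasis.ge_iff.2 fun u hu => ?_
    exact mem_iInf_of_mem (Ico a u)
      (mem_iInf_of_mem ⟨⟨le_rfl, hu⟩, a, u, rfl⟩ (mem_principal_self _))
  · refine le_iInf₂ fun s hs => ?_
    obtain ⟨ha, b, c, rfl⟩ := hs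
    rw [le_principal_iff]
    exact hbasis.mem_iff.2 ⟨c, ha.2, Ico_subset_Ico_left ha.1⟩

/-- A countable cover of a nonempty open interval of `ℝ` has a member that is dense in some
arbitrarily short subinterval. -/
theorem exists_Ioo_subset_closure {ι : Type*} [Countable ι] {a b : ℝ} (hab : a < b)
    (E : ι → Set ℝ) (hE : Ioo a b ⊆ ⋃ i, E i) (δ : ι → ℝ) (hδ : ∀ i, 0 < δ i) :
    ∃ i, ∃ p q, p < q ∧ q - p < δ i ∧ Ioo p q ⊆ closure (E i) := by
  have hdense : Dense (⋃ o : Option ι,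
      interior (o.elim (Ioo a b)ᶜ fun i => closure (E i))) := by
    apply dense_iUnion_interior_of_closed
    · rintro (_ | i)
      · exact isOpen_Ioo.isClosed_compl
      · exact isClosed_closure
    · refine eq_univ_of_forall fun x => mem_iUnion.2 ?_
      by_cases hx : x ∈ Ioo a b
      · obtain ⟨i, hi⟩ := mem_iUnion.1 (hE hx)
        exact ⟨some i, subset_closure hi⟩
      · exact ⟨none, hx⟩
  obtain ⟨x, hx, hxU⟩ := hdense.inter_open_nonempty _ isOpen_Ioo (nonempty_Ioo.2 hab)
  obtain ⟨o, ho⟩ := mem_iUnion.1 hxU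
  rcases o with _ | i
  · exact absurd hx (interior_subset ho)
  · have hnhds : closure (E i) ∈ 𝓝 x := mem_interior_iff_mem_nhds.1 ho
    obtain ⟨ε, hε, hball⟩ := Metric.mem_nhds_iff.1 hnhds
    have hpos : 0 < min ε (δ i) := lt_min hε (hδ i)
    refine ⟨i, x, x + min ε (δ i) / 2, by linarith, ?_, fun y hy => hball ?_⟩
    · have := min_le_right ε (δ i); linarith
    · have := min_le_left ε (δ i)
      rw [Metric.mem_ball, Real.dist_eq, abs_lt]
      constructor <;> linarith [hy.1, hy.2]

section Embedding

variable {X : Type*} [TopologicalSpace X] {g : ℝ → X}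

/-- An embedded copy of the Sorgenfrey line contains no left cluster point of itself. -/
theorem not_mapClusterPt_nhdsLT (hg : ∀ a, 𝓝[≥] a = comap g (𝓝 (g a))) (c d : ℝ) :
    ¬ MapClusterPt (g c) (𝓝[<] d) g := by
  intro h
  have hne : (𝓝[≥] c ⊓ 𝓝[<] d).NeBot := by
    rw [hg c]
    have : (𝓝 (g c) ⊓ map g (𝓝[<] d)).NeBot := h
    rw [← map_neBot_iff g, inf_comm, Filter.push_pull, inf_comm]
    exact this
  rcases lt_or_ge c d with hcd | hdc
  · obtain ⟨m, hcm, hmd⟩ := exists_between hcd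
    obtain ⟨x, hx⟩ := hne.nonempty_of_mem
      (inter_mem_inf (Ico_mem_nhdsGE hcm) (Ioo_mem_nhdsLT hmd))
    exact lt_asymm hx.1.2 hx.2.1
  · have hc : Ici c ∈ 𝓝[≥] c := self_mem_nhdsWithin
    have hd : Iio d ∈ 𝓝[<] d := self_mem_nhdsWithin
    obtain ⟨x, hx⟩ := hne.nonempty_of_mem (inter_mem_inf hc hd)
    exact (hdc.trans hx.1).not_gt hx.2

/-- A point near which the embedded Sorgenfrey line is bounded lies either on the line or is a
left cluster point of it. -/
theorem exists_eq_or_mapClusterPt [T2Space X] (hg : ∀ a, 𝓝[≥] a = comap g (𝓝 (g a)))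
    (hd : DenseRange g) {W : Set X} {a b : ℝ} (hgW : g ⁻¹' W ⊆ Icc a b) {x : X} (hx : W ∈ 𝓝 x) :
    ∃ d, x = g d ∨ MapClusterPt x (𝓝[<] d) g := by
  have : (comap g (𝓝 x)).NeBot := comap_neBot fun _ => hd.mem_nhds
  obtain ⟨U, hU⟩ := Ultrafilter.exists_le (comap g (𝓝 x))
  have hUx : Tendsto g U (𝓝 x) := tendsto_iff_comap.2 hU
  have hIcc : Icc a b ∈ U := mem_of_superset (hUx hx) hgW
  obtain ⟨d, -, hUd⟩ := isCompact_Icc.ultrafilter_le_nhds U (le_principal_iff.2 hIcc)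
  refine ⟨d, ?_⟩
  rcases U.mem_or_compl_mem (Ici d) with h | h
  · left
    have h1 : (U : Filter ℝ) ≤ comap g (𝓝 (g d)) := by
      rw [← hg]; exact le_inf hUd (le_principal_iff.2 h)
    exact tendsto_nhds_unique hUx (tendsto_iff_comap.2 h1)
  · right
    rw [compl_Ici] at h
    have h1 : (U : Filter ℝ) ≤ 𝓝[<] d := le_inf hUd (le_principal_iff.2 h)
    exact (hUx.mapClusterPt).mono h1

/-- The complement of a dense embedded Sorgenfrey line in a compact space is dense. -/
theorem exists_mem_notMem_range [T2Space X] [CompactSpace X]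
    (hg : ∀ a, 𝓝[≥] a = comap g (𝓝 (g a))) (hd : DenseRange g) {O : Set X} (hO : IsOpen O)
    (hne : O.Nonempty) : ∃ x ∈ O, x ∉ range g := by
  obtain ⟨c, hc⟩ := hd.exists_mem_open hO hne
  obtain ⟨K, hK, hKc, hKO⟩ := exists_mem_nhds_isClosed_subset (hO.mem_nhds hc)
  have h1 : g ⁻¹' K ∈ 𝓝[≥] c := by rw [hg]; exact preimage_mem_comap hK
  obtain ⟨u, hu, hsub⟩ := (nhdsGE_basis c).mem_iff.1 h1
  obtain ⟨d, hcd, hdu⟩ := exists_between (show c < u from hu)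
  obtain ⟨x, hx⟩ := exists_clusterPt_of_compactSpace (map g (𝓝[<] d))
  have hx' : MapClusterPt x (𝓝[<] d) g := hx
  refine ⟨x, hKO ?_, ?_⟩
  · have hK' : K ∈ map g (𝓝[<] d) := by
      refine mem_map.2 (mem_of_superset (Ioo_mem_nhdsLT hcd) fun y hy => ?_)
      exact hsub ⟨hy.1.le, hy.2.trans hdu⟩
    exact isClosed_iff_clusterPt.1 hKc x (hx.mono (le_principal_iff.2 hK'))
  · rintro ⟨e, rfl⟩
    exact not_mapClusterPt_nhdsLT hg e d hx'

end Embedding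

/-- The points `t` mapped by `f` to a point `g d` with `d ≥ 0` such that `f` takes no value `g e`
with `e < d` on `[t, t + δ)`. -/
def lineTimes {X : Type*} (f g : ℝ → X) (δ : ℝ) : Set ℝ :=
  {t | ∃ d, f t = g d ∧ 0 ≤ d ∧ ∀ s ∈ Ico t (t + δ), ∀ e, f s = g e → d ≤ e}

section OpenImage

variable {X : Type*} [TopologicalSpace X] {f g : ℝ → X}

/-- The points `t` mapped by `f` to a left cluster point of `g` at some `d` in the `i`-th interval
of length `δ`, such that `f` takes no left cluster point of `g` at any `e ∈ (d, d + δ)` as a value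
on `[t, t + δ)`. -/
def clusterTimes (f g : ℝ → X) (δ : ℝ) (i : ℤ) : Set ℝ :=
  {t | ∃ d, MapClusterPt (f t) (𝓝[<] d) g ∧ i * δ ≤ d ∧ d < (i + 1) * δ ∧
    ∀ s ∈ Ico t (t + δ), ∀ e, MapClusterPt (f s) (𝓝[<] e) g → e ∉ Ioo d (d + δ)}

theorem exists_mem_lineTimes (hg : ∀ a, 𝓝[≥] a = comap g (𝓝 (g a)))
    (hf : ∀ a, Tendsto f (𝓝[≥] a) (𝓝 (f a))) {t d : ℝ} (htd : f t = g d) (hd : 0 ≤ d) :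
    ∃ n : ℕ, t ∈ lineTimes f g (1 / (n + 1)) := by
  have h1 : Ici d ∈ comap g (𝓝 (g d)) := by rw [← hg]; exact self_mem_nhdsWithin
  obtain ⟨A, hA, hAd⟩ := mem_comap.1 h1
  rw [← htd] at hA
  obtain ⟨u, hu, hsub⟩ := (nhdsGE_basis t).mem_iff.1 (hf t hA)
  obtain ⟨n, hn⟩ := exists_nat_one_div_lt (sub_pos.2 (show t < u from hu))
  refine ⟨n, d, htd, hd, fun s hs e he => hAd ?_⟩
  have : f s ∈ A := hsub ⟨hs.1, by linarith [hs.2]⟩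
  rwa [he] at this

theorem exists_mem_clusterTimes [T2Space X]
    (hg : ∀ a, 𝓝[≥] a = comap g (𝓝 (g a)))
    (hf : ∀ a, Tendsto f (𝓝[≥] a) (𝓝 (f a))) {t d : ℝ} (htd : MapClusterPt (f t) (𝓝[<] d) g) :
    ∃ (n : ℕ) (i : ℤ), t ∈ clusterTimes f g (1 / (n + 1)) i := by
  have hne : f t ≠ g d := fun h => not_mapClusterPt_nhdsLT hg d d (h ▸ htd)
  obtain ⟨A, B, hA, hB, htA, hdB, hAB⟩ := t2_separation hne
  obtain ⟨u, hu, hsubA⟩ := (nhdsGE_basis t).mem_iff.1 (hf t (hA.mem_nhds htA))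
  have h1 : g ⁻¹' B ∈ 𝓝[≥] d := by rw [hg]; exact preimage_mem_comap (hB.mem_nhds hdB)
  obtain ⟨v, hv, hsubB⟩ := (nhdsGE_basis d).mem_iff.1 h1
  obtain ⟨n, hn⟩ := exists_nat_one_div_lt
    (lt_min (sub_pos.2 (show t < u from hu)) (sub_pos.2 (show d < v from hv)))
  have hnu := hn.trans_le (min_le_left _ _)
  have hnv := hn.trans_le (min_le_right _ _)
  have hpos : (0 : ℝ) < 1 / (n + 1) := Nat.one_div_pos_of_nat
  refine ⟨n, ⌊d / (1 / (n + 1))⌋, d, htd, ?_, ?_, fun s hs e he hed => ?_⟩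
  · exact (le_div_iff₀ hpos).1 (Int.floor_le _)
  · exact (div_lt_iff₀ hpos).1 (Int.lt_floor_add_one _)
  · have hsA : f s ∈ A := hsubA ⟨hs.1, by linarith [hs.2]⟩
    obtain ⟨c, hcA, hc⟩ := ((he.frequently (hA.mem_nhds hsA)).and_eventually
      (Ioo_mem_nhdsLT hed.1)).exists
    exact disjoint_left.1 hAB hcA (hsubB ⟨hc.1.le, by linarith [hc.2, hed.2]⟩)

theorem exists_mem_Ioo_of_subset_closure {E : Set ℝ} {p q t u : ℝ} (hE : Ioo p q ⊆ closure E)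
    (hpt : p ≤ t) (htq : t < q) (htu : t < u) : ∃ s ∈ E, s ∈ Ioo t u ∧ s < q := by
  obtain ⟨y, hty, hy⟩ := exists_between (lt_min htu htq)
  obtain ⟨s, hs, hsE⟩ := mem_closure_iff.1
    (hE ⟨hpt.trans_lt hty, hy.trans_le (min_le_right _ _)⟩) (Ioo t (min u q)) isOpen_Ioo ⟨hty, hy⟩
  exact ⟨s, hsE, ⟨hs.1, hs.2.trans_le (min_le_left _ _)⟩, hs.2.trans_le (min_le_right _ _)⟩

theorem mem_range_of_subset_closure_lineTimes [T2Space X]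
    (hg : ∀ a, 𝓝[≥] a = comap g (𝓝 (g a)))
    (hf : ∀ a, Tendsto f (𝓝[≥] a) (𝓝 (f a))) {p q δ t : ℝ} (hqp : q - p < δ)
    (hE : Ioo p q ⊆ closure (lineTimes f g δ)) (ht : t ∈ Ico p q) : f t ∈ range g := by
  set T : Set ℝ := {d | ∃ s ∈ Ioo t q, f s = g d ∧ 0 ≤ d ∧
    ∀ s' ∈ Ico s (s + δ), ∀ e, f s' = g e → d ≤ e}
  have hTbdd : BddBelow T := ⟨0, fun d ⟨_, _, _, h, _⟩ => h⟩
  have hTne : T.Nonempty := by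
    obtain ⟨s, ⟨d, hd⟩, hs, -⟩ := exists_mem_Ioo_of_subset_closure hE ht.1 ht.2 ht.2
    exact ⟨d, s, hs, hd⟩
  refine ⟨sInf T, ?_⟩
  by_contra hne
  obtain ⟨B, A, hB, hA, hdB, htA, hAB⟩ := t2_separation hne
  obtain ⟨u, hu, hsubA⟩ := (nhdsGE_basis t).mem_iff.1 (hf t (hA.mem_nhds htA))
  have h1 : g ⁻¹' B ∈ 𝓝[≥] (sInf T) := by rw [hg]; exact preimage_mem_comap (hB.mem_nhds hdB)
  obtain ⟨v, hv, hsubB⟩ := (nhdsGE_basis (sInf T)).mem_iff.1 h1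
  obtain ⟨d, ⟨s, hs, hsd, -, -⟩, hdv⟩ := exists_lt_of_csInf_lt hTne hv
  obtain ⟨s', ⟨d', hd'⟩, hs', hs'q⟩ :=
    exists_mem_Ioo_of_subset_closure hE ht.1 ht.2 (lt_min (show t < u from hu) hs.1)
  have hs'u := hs'.2.trans_le (min_le_left _ _)
  have hs's := hs'.2.trans_le (min_le_right _ _)
  have hle : sInf T ≤ d' := csInf_le hTbdd ⟨s', ⟨hs'.1, hs'q⟩, hd'⟩
  have hle' : d' ≤ d := hd'.2.2 s ⟨hs's.le, by linarith [hs.2, hs'.1, ht.1]⟩ d hsd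
  have hmA : f s' ∈ A := hsubA ⟨hs'.1.le, hs'u⟩
  have hmB : g d' ∈ B := hsubB ⟨hle, hle'.trans_lt hdv⟩
  rw [hd'.1] at hmA
  exact disjoint_left.1 hAB hmB hmA

theorem exists_mapClusterPt_of_subset_closure_clusterTimes
    (hf : ∀ a, Tendsto f (𝓝[≥] a) (𝓝 (f a))) {p q δ t : ℝ} {i : ℤ} (hqp : q - p < δ)
    (hE : Ioo p q ⊆ closure (clusterTimes f g δ i)) (ht : t ∈ Ico p q) :
    ∃ d, MapClusterPt (f t) (𝓝[<] d) g := by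
  set T : Set ℝ := {d | ∃ s ∈ Ioo t q, MapClusterPt (f s) (𝓝[<] d) g ∧ i * δ ≤ d ∧
    d < (i + 1) * δ ∧ ∀ s' ∈ Ico s (s + δ), ∀ e, MapClusterPt (f s') (𝓝[<] e) g →
      e ∉ Ioo d (d + δ)}
  have hTbdd : BddAbove T := ⟨(i + 1) * δ, fun d ⟨_, _, _, _, h, _⟩ => h.le⟩
  have hTne : T.Nonempty := by
    obtain ⟨s, ⟨d, hd⟩, hs, -⟩ := exists_mem_Ioo_of_subset_closure hE ht.1 ht.2 ht.2
    exact ⟨d, s, hs, hd⟩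
  refine ⟨sSup T, ?_⟩
  rw [mapClusterPt_iff_frequently]
  intro A₀ hA₀
  obtain ⟨A, hAA₀, hA, htA⟩ := mem_nhds_iff.1 hA₀
  rw [(nhdsLT_basis (sSup T)).frequently_iff]
  intro w hw
  obtain ⟨u, hu, hsubA⟩ := (nhdsGE_basis t).mem_iff.1 (hf t (hA.mem_nhds htA))
  obtain ⟨d, ⟨s, hs, hsd, -, hid', -⟩, hwd⟩ := exists_lt_of_lt_csSup hTne hw
  obtain ⟨s', ⟨d', hd'⟩, hs', hs'q⟩ :=
    exists_mem_Ioo_of_subset_closure hE ht.1 ht.2 (lt_min (show t < u from hu) hs.1)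
  have hs'u := hs'.2.trans_le (min_le_left _ _)
  have hs's := hs'.2.trans_le (min_le_right _ _)
  have hle : d' ≤ sSup T := le_csSup hTbdd ⟨s', ⟨hs'.1, hs'q⟩, hd'⟩
  have hle' : d ≤ d' := by
    by_contra! hlt
    exact hd'.2.2.2 s ⟨hs's.le, by linarith [hs.2, hs'.1, ht.1]⟩ d hsd
      ⟨hlt, by linarith [hd'.2.1, hid']⟩
  have hmA : f s' ∈ A := hsubA ⟨hs'.1.le, hs'u⟩
  obtain ⟨c, hcA, hc⟩ := ((hd'.1.frequently (hA.mem_nhds hmA)).and_eventually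
    (Ioo_mem_nhdsLT (hwd.trans_le hle'))).exists
  exact ⟨c, ⟨hc.1, hc.2.trans_le hle⟩, hAA₀ hcA⟩

theorem not_surjective_of_sorgenfrey_open_map [T2Space X] [CompactSpace X]
    (hg : ∀ a, 𝓝[≥] a = comap g (𝓝 (g a))) (hd : DenseRange g)
    (hf : ∀ a, Tendsto f (𝓝[≥] a) (𝓝 (f a)))
    (hopen : ∀ p q, IsOpen (f '' Ico p q)) : ¬ Surjective f := by
  intro hsurj
  have h0 : Ico (0 : ℝ) 1 ∈ comap g (𝓝 (g 0)) := by
    rw [← hg]; exact Ico_mem_nhdsGE one_pos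
  obtain ⟨W₀, hW₀, hgW₀⟩ := mem_comap.1 h0
  obtain ⟨W, hWW₀, hW, h0W⟩ := mem_nhds_iff.1 hW₀
  have hgW : g ⁻¹' W ⊆ Icc 0 1 :=
    (preimage_mono hWW₀).trans (hgW₀.trans Ico_subset_Icc_self)
  obtain ⟨t₀, ht₀⟩ := hsurj (g 0)
  rw [← ht₀] at h0W
  obtain ⟨u, hu, hsub⟩ := (nhdsGE_basis t₀).mem_iff.1 (hf t₀ (hW.mem_nhds h0W))
  let E : ℕ ⊕ ℕ × ℤ → Set ℝ := Sum.elim (fun n => lineTimes f g (1 / (n + 1)))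
    fun k => clusterTimes f g (1 / (k.1 + 1)) k.2
  have hcover : Ioo t₀ u ⊆ ⋃ k, E k := by
    intro t ht
    have htW : f t ∈ W := hsub (Ioo_subset_Ico_self ht)
    obtain ⟨d, hd | hd⟩ := exists_eq_or_mapClusterPt hg hd hgW (hW.mem_nhds htW)
    · have hd0 : 0 ≤ d := (hgW (show g d ∈ W from hd ▸ htW)).1
      obtain ⟨n, hn⟩ := exists_mem_lineTimes hg hf hd hd0
      exact mem_iUnion.2 ⟨Sum.inl n, hn⟩
    · obtain ⟨n, i, hn⟩ := exists_mem_clusterTimes hg hf hd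
      exact mem_iUnion.2 ⟨Sum.inr (n, i), hn⟩
  obtain ⟨k, p, q, hpq, hδ, hE⟩ := exists_Ioo_subset_closure hu E hcover
    (Sum.elim (fun n => 1 / (n + 1)) fun k => 1 / (k.1 + 1))
    (by rintro (n | n) <;> exact Nat.one_div_pos_of_nat)
  have hne : (f '' Ico p q).Nonempty := (nonempty_Ico.2 hpq).image f
  rcases k with n | ⟨n, i⟩
  · obtain ⟨_, ⟨t, ht, rfl⟩, hnot⟩ := exists_mem_notMem_range hg hd (hopen p q) hne
    exact hnot (mem_range_of_subset_closure_lineTimes hg hf hδ hE ht)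
  · obtain ⟨c, t, ht, htc⟩ := hd.exists_mem_open (hopen p q) hne
    obtain ⟨d, hd⟩ := exists_mapClusterPt_of_subset_closure_clusterTimes hf hδ hE ht
    exact not_mapClusterPt_nhdsLT hg c d (htc ▸ hd)

end OpenImage

/-- The inverse of a homeomorphism from a dense subspace is an embedding with dense range. -/
theorem Homeomorph.nhds_eq_comap_and_denseRange_coe_symm {X Y : Type*} [TopologicalSpace X]
    [TopologicalSpace Y] {D : Set X} (hD : Dense D) (e : D ≃ₜ Y) :
    (∀ y, 𝓝 y = comap (fun y => (e.symm y : X)) (𝓝 (e.symm y : X))) ∧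
      DenseRange fun y => (e.symm y : X) :=
  ⟨(IsEmbedding.subtypeVal.comp e.symm.isEmbedding).isInducing.nhds_eq_comap,
    hD.denseRange_val.comp e.symm.surjective.denseRange continuous_subtype_val⟩

/-- No Hausdorff compactification of the Sorgenfrey line is a continuous open
image of the Sorgenfrey line. -/
theorem stmt16 {X : Type*} (τ : TopologicalSpace X) (hT2 : @T2Space X τ)
    (hc : @CompactSpace X τ) (D : Set X) (hd : @Dense X τ D)
    (h : Nonempty (@Homeomorph ↥D ℝ (TopologicalSpace.induced Subtype.val τ) sorgenfreyTop)) :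
    ¬ ∃ f : ℝ → X, @Continuous ℝ X sorgenfreyTop τ f ∧
      @IsOpenMap ℝ X sorgenfreyTop τ f ∧ Function.Surjective f := by
  rintro ⟨f, hcont, hopen, hsurj⟩
  obtain ⟨e⟩ := h
  obtain ⟨hg, hdense⟩ :=
    @Homeomorph.nhds_eq_comap_and_denseRange_coe_symm X ℝ τ sorgenfreyTop D hd e
  refine not_surjective_of_sorgenfrey_open_map (f := f) (fun a => ?_) hdense (fun a => ?_)
    (fun p q => ?_) hsurj
  · rw [← nhds_sorgenfreyTop]
    exact hg a
  · rw [← nhds_sorgenfreyTop]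
    exact (@Continuous.tendsto ℝ X sorgenfreyTop τ f hcont a)
  · exact hopen _ (TopologicalSpace.isOpen_generateFrom_of_mem ⟨p, q, rfl⟩)
end
end
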